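/- Let q ∈ ℂ be a non-root of unity, m ≤ n positive integers, and γ ∈ Π_{m,n}. Then the two-sided ideal I_γ of O_q(G_{m,n}(ℂ)) generated by Ω_γ = {[π] : π ∈ Π_{m,n}, π ≱st γ} equals the ℂ-linear span of the standard monomials [I₁]⋯[I_s] (I₁ ≤st ⋯ ≤st I_s) which involve an element of Ω_γ, i.e. with I₁ ∈ Ω_γ. Moreover I_γ is generated by Ω_γ as a right ideal. -/

import Mathlib

/-- The defining relations of the algebra of quantum `m × n` matrices, with parameter the
unit `u`, imposed on the free algebra on the generators `X (i,j)`. -/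
inductive qMatrixRel (R : Type*) [CommRing R] (u : Rˣ) (m n : ℕ) :
    FreeAlgebra R (Fin m × Fin n) → FreeAlgebra R (Fin m × Fin n) → Prop
  | row : ∀ (i : Fin m) (j l : Fin n), j < l →
      qMatrixRel R u m n (FreeAlgebra.ι R (i, j) * FreeAlgebra.ι R (i, l))
        ((u : R) • (FreeAlgebra.ι R (i, l) * FreeAlgebra.ι R (i, j)))
  | col : ∀ (i k : Fin m) (j : Fin n), i < k →
      qMatrixRel R u m n (FreeAlgebra.ι R (i, j) * FreeAlgebra.ι R (k, j))
        ((u : R) • (FreeAlgebra.ι R (k, j) * FreeAlgebra.ι R (i, j)))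
  | antidiag : ∀ (i k : Fin m) (j l : Fin n), k < i → j < l →
      qMatrixRel R u m n (FreeAlgebra.ι R (i, j) * FreeAlgebra.ι R (k, l))
        (FreeAlgebra.ι R (k, l) * FreeAlgebra.ι R (i, j))
  | diag : ∀ (i k : Fin m) (j l : Fin n), i < k → j < l →
      qMatrixRel R u m n (FreeAlgebra.ι R (i, j) * FreeAlgebra.ι R (k, l))
        (FreeAlgebra.ι R (k, l) * FreeAlgebra.ι R (i, j) +
          ((u : R) - ((u⁻¹ : Rˣ) : R)) • (FreeAlgebra.ι R (i, l) * FreeAlgebra.ι R (k, j)))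

/-- The algebra `O_u(M_{m,n}(R))` of quantum `m × n` matrices over `R`. -/
abbrev QuantumMat (R : Type*) [CommRing R] (u : Rˣ) (m n : ℕ) :=
  RingQuot (qMatrixRel R u m n)

/-- The generator `X i j` of the algebra of quantum matrices. -/
def qX (R : Type*) [CommRing R] (u : Rˣ) {m n : ℕ} (i : Fin m) (j : Fin n) :
    QuantumMat R u m n :=
  RingQuot.mkAlgHom R (qMatrixRel R u m n) (FreeAlgebra.ι R (i, j))

/-- The number of inversions (i.e. the Coxeter length) of a permutation of `Fin t`. -/
def permLength {t : ℕ} (σ : Equiv.Perm (Fin t)) : ℕ :=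
  (Finset.univ.filter fun p : Fin t × Fin t => p.1 < p.2 ∧ σ p.2 < σ p.1).card

/-- The index set `Π_{m,n}` of maximal quantum minors consists of the `m`-element subsets
`{j₁ < ⋯ < j_m} ⊆ {1,…,n}`, encoded as order embeddings `Fin m ↪o Fin n`; it carries the
standard partial order `I ≤st J ↔ ∀ s, i_s ≤ j_s` (pointwise order). -/
instance piPartialOrder (m n : ℕ) : PartialOrder (Fin m ↪o Fin n) :=
  PartialOrder.lift (fun f => (f : Fin m → Fin n)) DFunLike.coe_injective

instance piFinite (m n : ℕ) : Finite (Fin m ↪o Fin n) :=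
  Finite.of_injective (fun f => (f : Fin m → Fin n)) DFunLike.coe_injective

/-- The maximal quantum minor `[J] = Σ_{σ ∈ S_m} (−u)^{ℓ(σ)} X_{1 j_{σ(1)}} ⋯ X_{m j_{σ(m)}}`
of the generic matrix, for a column index set `J ∈ Π_{m,n}`. -/
def qMaximalMinor (R : Type*) [CommRing R] (u : Rˣ) {m n : ℕ} (J : Fin m ↪o Fin n) :
    QuantumMat R u m n :=
  ∑ σ : Equiv.Perm (Fin m),
    ((-(u : R)) ^ permLength σ) • (List.ofFn fun i : Fin m => qX R u i (J (σ i))).prod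

/-- The quantum grassmannian `O_q(G_{m,n}(K))`: the `K`-subalgebra of `O_q(M_{m,n}(K))`
generated by the maximal quantum minors `[J]`, `J ∈ Π_{m,n}`. -/
def QuantumGrassmannian (K : Type*) [CommRing K] (u : Kˣ) (m n : ℕ) :
    Subalgebra K (QuantumMat K u m n) :=
  Algebra.adjoin K (Set.range fun J : Fin m ↪o Fin n => qMaximalMinor K u J)

/-- The maximal quantum minor `[J]` viewed as an element of the quantum grassmannian. -/
def grMinor (K : Type*) [CommRing K] (u : Kˣ) {m n : ℕ} (J : Fin m ↪o Fin n) :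
    QuantumGrassmannian K u m n :=
  ⟨qMaximalMinor K u J, Algebra.subset_adjoin ⟨J, rfl⟩⟩

section QuantumAlternation

variable {K : Type*} [Field K] {V W : Type*} [AddCommGroup V] [Module K V] [AddCommGroup W]
  [Module K W] {α β : Type*} [LinearOrder α] [LinearOrder β]

/-- The `q`-alternating sum of `F` over the arrangements of `k` distinct elements of `T`. When
`T` has `k` elements, the arrangement `c` gets the coefficient `(-q) ^ listInv c`. -/
def qAlt (q : K) : ℕ → Finset β → (List β → V) →ₗ[K] V
  | 0, _ => LinearMap.proj []
  | k + 1, T => ∑ j ∈ T, (-q) ^ (T.filter (· < j)).card •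
      (qAlt q k (T.erase j)) ∘ₗ LinearMap.funLeft K V (List.cons j)

variable {q : K}

theorem qAlt_zero (T : Finset β) (F : List β → V) : qAlt q 0 T F = F [] := rfl

theorem qAlt_succ (k : ℕ) (T : Finset β) (F : List β → V) :
    qAlt q (k + 1) T F = ∑ j ∈ T, (-q) ^ (T.filter (· < j)).card •
      qAlt q k (T.erase j) (fun c => F (j :: c)) := by
  simp only [qAlt, LinearMap.sum_apply, LinearMap.smul_apply]
  rfl

theorem qAlt_map (φ : V →ₗ[K] W) (k : ℕ) (T : Finset β) (F : List β → V) :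
    φ (qAlt q k T F) = qAlt q k T (fun c => φ (F c)) := by
  induction k generalizing T F with
  | zero => rfl
  | succ k ih => simp only [qAlt_succ, map_sum, map_smul, ih]

theorem qAlt_congr {k : ℕ} {T : Finset β} {F G : List β → V}
    (h : ∀ c : List β, c.length = k → c.Nodup → (∀ b ∈ c, b ∈ T) → F c = G c) :
    qAlt q k T F = qAlt q k T G := by
  induction k generalizing T F G with
  | zero => exact h [] rfl List.nodup_nil (by simp)
  | succ k ih =>
    rw [qAlt_succ, qAlt_succ]
    refine Finset.sum_congr rfl fun j hj => ?_
    rw [ih fun c hc hnd hT => h (j :: c) (by simp [hc]) ?_ ?_]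
    · exact List.nodup_cons.2 ⟨fun hjc => by simpa using hT j hjc, hnd⟩
    · intro b hb
      rcases List.mem_cons.1 hb with rfl | hb
      · exact hj
      · exact Finset.mem_of_mem_erase (hT b hb)

theorem qAlt_mem (N : Submodule K V) {k : ℕ} {T : Finset β} {F : List β → V}
    (h : ∀ c : List β, c.length = k → c.Nodup → (∀ b ∈ c, b ∈ T) → F c ∈ N) :
    qAlt q k T F ∈ N := by
  have h0 : N.mkQ (qAlt q k T F) = 0 := by
    rw [qAlt_map, qAlt_congr (G := fun _ => (0 : V ⧸ N))]
    · exact map_zero _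
    · intro c h1 h2 h3
      simpa using h c h1 h2 h3
  simpa using h0

theorem qAlt_comm (k l : ℕ) (S : Finset α) (T : Finset β) (F : List α → List β → V) :
    qAlt q k S (fun r => qAlt q l T (fun c => F r c)) =
      qAlt q l T (fun c => qAlt q k S (fun r => F r c)) := by
  induction k generalizing S F with
  | zero => rfl
  | succ k ih =>
    simp only [qAlt_succ, ih]
    have : (fun c => ∑ j ∈ S, (-q) ^ (S.filter (· < j)).card •
        qAlt q k (S.erase j) fun r => F (j :: r) c) =
        ∑ j ∈ S, (-q) ^ (S.filter (· < j)).card •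
          fun c => qAlt q k (S.erase j) fun r => F (j :: r) c := by
      ext c; simp
    rw [this]
    simp only [map_sum, map_smul]

theorem card_filter_erase_add_one {T : Finset β} {j : β} (p : β → Prop) [DecidablePred p]
    (hj : j ∈ T) (hp : p j) :
    ((T.erase j).filter p).card + 1 = (T.filter p).card := by
  rw [Finset.filter_erase, Finset.card_erase_add_one]
  simp [hj, hp]

theorem card_filter_erase_of_not {T : Finset β} {j : β} (p : β → Prop) [DecidablePred p]
    (hp : ¬ p j) : ((T.erase j).filter p).card = (T.filter p).card := by
  rw [Finset.filter_erase, Finset.erase_eq_of_notMem]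
  simp [hp]

theorem qAlt_eq_zero_of_head {k : ℕ} {T : Finset β} {F : List β → V}
    (h : ∀ (a b : β) (v : List β), a < b → F (a :: b :: v) = q • F (b :: a :: v)) :
    qAlt q (k + 2) T F = 0 := by
  simp only [qAlt_succ, Finset.smul_sum, smul_smul]
  rw [Finset.sum_sigma']
  have key : ∀ a b : β, a ∈ T → b ∈ T → a < b →
      ((-q) ^ (T.filter (· < a)).card * (-q) ^ ((T.erase a).filter (· < b)).card) •
        qAlt q k ((T.erase a).erase b) (fun c => F (a :: b :: c)) +
      ((-q) ^ (T.filter (· < b)).card * (-q) ^ ((T.erase b).filter (· < a)).card) •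
        qAlt q k ((T.erase b).erase a) (fun c => F (b :: a :: c)) = 0 := by
    intro a b ha hb hab
    have h1 := card_filter_erase_add_one (· < b) ha hab
    have h2 := card_filter_erase_of_not (T := T) (j := b) (· < a) (not_lt.2 hab.le)
    have h3 : (fun c => F (a :: b :: c)) = q • fun c => F (b :: a :: c) := by
      ext c; simp [h a b c hab]
    rw [h3, map_smul, ← h1, h2, Finset.erase_right_comm, smul_smul, ← add_smul]
    convert zero_smul K _
    ring
  refine Finset.sum_involution (fun p _ => ⟨p.2, p.1⟩) ?_ ?_ ?_ ?_
  · rintro ⟨a, b⟩ hp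
    simp only [Finset.mem_sigma, Finset.mem_erase] at hp
    rcases lt_or_gt_of_ne hp.2.1 with hab | hab
    · rw [add_comm]
      exact key b a hp.2.2 hp.1 hab
    · exact key a b hp.1 hp.2.2 hab
  · rintro ⟨a, b⟩ hp _ heq
    simp only [Finset.mem_sigma, Finset.mem_erase] at hp
    simp only [Sigma.mk.injEq] at heq
    exact hp.2.1 heq.1
  · rintro ⟨a, b⟩ hp
    simp only [Finset.mem_sigma, Finset.mem_erase] at hp ⊢
    exact ⟨hp.2.2, hp.2.1.symm, hp.1⟩
  · rintro ⟨a, b⟩ _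
    rfl

/-- The number of inversions of a list. -/
def listInv : List β → ℕ
  | [] => 0
  | a :: l => l.countP (· < a) + listInv l

theorem countP_eq_card_filter {l : List β} {T : Finset β} (hl : l.Nodup) (hT : l.toFinset = T)
    (p : β → Prop) [DecidablePred p] : l.countP (fun b => p b) = (T.filter p).card := by
  rw [← hT, List.countP_eq_length_filter, ← List.toFinset_card_of_nodup (hl.filter _),
    List.toFinset_filter]
  simp

theorem toFinset_eq_of_arrangement {l : List β} {T : Finset β} (hlen : l.length = T.card)
    (hnd : l.Nodup) (hT : ∀ b ∈ l, b ∈ T) : l.toFinset = T :=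
  Finset.eq_of_subset_of_card_le (fun b hb => hT b (by simpa using hb))
    (by rw [List.toFinset_card_of_nodup hnd, hlen])

theorem sum_pow_card_filter_lt (y : K) (T : Finset β) :
    ∑ j ∈ T, y ^ (T.filter (· < j)).card = ∑ i ∈ Finset.range T.card, y ^ i := by
  induction T using Finset.induction_on_max with
  | empty => simp
  | insert a s ha ih =>
    have has : a ∉ s := fun h => lt_irrefl _ (ha a h)
    rw [Finset.sum_insert has, Finset.card_insert_of_notMem has, Finset.sum_range_succ, ← ih,
      add_comm]
    congr 1
    · refine Finset.sum_congr rfl fun j hj => ?_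
      rw [Finset.filter_insert, if_neg (not_lt.2 (ha j hj).le)]
    · rw [Finset.filter_insert, if_neg (lt_irrefl a), Finset.filter_true_of_mem ha]

/-- The `q²`-factorial `∏_{i < k} (1 + q² + ⋯ + q^{2i})`. -/
def qFact (q : K) (k : ℕ) : K :=
  ∏ i ∈ Finset.range k, ∑ j ∈ Finset.range (i + 1), (q ^ 2) ^ j

theorem qFact_ne_zero (hroot : ∀ s : ℕ, 0 < s → q ^ s ≠ 1) (k : ℕ) : qFact q k ≠ 0 := by
  refine Finset.prod_ne_zero_iff.2 fun i _ h => hroot (2 * (i + 1)) (by omega) ?_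
  have := geom_sum_mul (q ^ 2) (i + 1)
  rw [h, zero_mul] at this
  rw [pow_mul]
  exact (sub_eq_zero.1 this.symm)

theorem qAlt_listInv (k : ℕ) (T : Finset β) (hT : T.card = k) (v : V) :
    qAlt q k T (fun c => (-q) ^ listInv c • v) = qFact q k • v := by
  induction k generalizing T v with
  | zero => simp [qAlt_zero, listInv, qFact]
  | succ k ih =>
    rw [qAlt_succ]
    have : ∀ j ∈ T, (-q) ^ (T.filter (· < j)).card • qAlt q k (T.erase j)
        (fun c => (-q) ^ listInv (j :: c) • v) =
        (q ^ 2) ^ (T.filter (· < j)).card • qFact q k • v := by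
      intro j hj
      have hc : (T.erase j).card = k := by rw [Finset.card_erase_of_mem hj, hT]; rfl
      rw [qAlt_congr (G := fun c => (-q) ^ listInv c • (-q) ^ (T.filter (· < j)).card • v),
        ih _ hc, smul_comm (qFact q k), smul_smul, ← pow_add, ← two_mul, pow_mul, neg_sq]
      intro c hlen hnd hmem
      rw [listInv, countP_eq_card_filter hnd
        (toFinset_eq_of_arrangement (hlen.trans hc.symm) hnd hmem) (· < j),
        card_filter_erase_of_not (· < j) (lt_irrefl j), smul_smul, pow_add, mul_comm]
    rw [Finset.sum_congr rfl this, ← Finset.sum_smul, sum_pow_card_filter_lt, hT, smul_smul,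
      qFact, qFact, Finset.prod_range_succ, mul_comm]

/-- If `L` lies below `U`, then modulo terms that place an element of `L` among the first `|U|`
entries, the alternating sum over `L ∪ U` splits. -/
theorem qAlt_union_sub_mem (N : Submodule K V) (L : Finset β) (t : ℕ) (U : Finset β)
    (hU : U.card = t) (hLU : ∀ l ∈ L, ∀ u ∈ U, l < u) (F : List β → V)
    (hF : ∀ c : List β, c.length = t + L.card → c.Nodup → (∀ b ∈ c, b ∈ L ∪ U) →
      (∃ l ∈ c.take t, l ∈ L) → F c ∈ N) :
    qAlt q (t + L.card) (L ∪ U) F - (-q) ^ (t * L.card) •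
      qAlt q t U (fun c => qAlt q L.card L (fun d => F (c ++ d))) ∈ N := by
  induction t generalizing U F with
  | zero =>
    obtain rfl := Finset.card_eq_zero.1 hU
    simp [qAlt_zero]
  | succ t ih =>
    have hdisj : Disjoint L U := Finset.disjoint_left.2 fun a h1 h2 => lt_irrefl _ (hLU a h1 a h2)
    rw [show t + 1 + L.card = (t + L.card) + 1 by ring, qAlt_succ, qAlt_succ,
      Finset.sum_union hdisj, Finset.smul_sum, add_sub_assoc, ← Finset.sum_sub_distrib]
    have hnodup : ∀ (j : β) (c : List β), c.Nodup → (∀ b ∈ c, b ∈ (L ∪ U).erase j) →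
        (j :: c).Nodup := fun j c hnd hc =>
      List.nodup_cons.2 ⟨fun hjc => by simpa using hc j hjc, hnd⟩
    refine N.add_mem (N.sum_mem fun j hj => N.smul_mem _ (qAlt_mem N ?_))
      (N.sum_mem fun j hj => ?_)
    · intro c hlen hnd hc
      refine hF (j :: c) (by simp [hlen]; ring) (hnodup j c hnd hc) ?_ ⟨j, by simp, hj⟩
      intro b hb
      rcases List.mem_cons.1 hb with rfl | hb
      · exact Finset.mem_union_left _ hj
      · exact Finset.mem_of_mem_erase (hc b hb)
    · have hjL : j ∉ L := fun h => lt_irrefl _ (hLU j h j hj)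
      have hcard : ((L ∪ U).filter (· < j)).card = L.card + (U.filter (· < j)).card := by
        rw [Finset.filter_union, Finset.card_union_of_disjoint
          (Finset.disjoint_filter_filter hdisj), Finset.filter_true_of_mem]
        exact fun l hl => hLU l hl j hj
      have herase : (L ∪ U).erase j = L ∪ U.erase j := by
        rw [Finset.erase_union_distrib, Finset.erase_eq_of_notMem hjL]
      have := ih (U.erase j) (by rw [Finset.card_erase_of_mem hj, hU]; rfl)
        (fun l hl u hu => hLU l hl u (Finset.mem_of_mem_erase hu)) (fun c => F (j :: c)) (by
          intro c hlen hnd hc hex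
          rw [← herase] at hc
          refine hF (j :: c) (by simp [hlen]; ring) (hnodup j c hnd hc) ?_ ?_
          · intro b hb
            rcases List.mem_cons.1 hb with rfl | hb
            · exact Finset.mem_union_right _ hj
            · exact Finset.mem_of_mem_erase (hc b hb)
          · obtain ⟨l, h1, h2⟩ := hex
            exact ⟨l, by simp [h1], h2⟩)
      have h2 := N.smul_mem ((-q) ^ (L.card + (U.filter (· < j)).card)) this
      rw [smul_sub, smul_smul] at h2
      rw [hcard, herase, smul_smul]
      convert h2 using 3
      · ring
      · rfl

end QuantumAlternation

section QuantumMinors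

variable {K : Type*} [Field K] {B : Type*} [Ring B] [Algebra K B]
  {α β : Type*}

/-- The product `x r₁ c₁ * x r₂ c₂ * ⋯`, or `0` if the lists have different lengths. -/
def entryProd (x : α → β → B) : List α → List β → B
  | [], [] => 1
  | a :: r, b :: c => x a b * entryProd x r c
  | [], _ :: _ => 0
  | _ :: _, [] => 0

theorem entryProd_flip (x : α → β → B) (r : List α) (c : List β) :
    entryProd (fun j i => x i j) c r = entryProd x r c := by
  induction r generalizing c with
  | nil => cases c <;> rfl
  | cons a r ih => cases c with
    | nil => rfl
    | cons b c => simp [entryProd, ih]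

theorem entryProd_append (x : α → β → B) (r r' : List α) (c c' : List β)
    (h : r.length = c.length) :
    entryProd x (r ++ r') (c ++ c') = entryProd x r c * entryProd x r' c' := by
  induction r generalizing c with
  | nil =>
    obtain rfl := List.length_eq_zero_iff.1 h.symm
    simp [entryProd]
  | cons a r ih => cases c with
    | nil => simp at h
    | cons b c => simp [entryProd, ih c (by simpa using h), mul_assoc]

variable [LinearOrder β]

/-- The quantum minor with rows listed in `r` (in this order) and set of columns `T`. -/
def rowMinor (q : K) (x : α → β → B) (r : List α) (T : Finset β) : B :=
  qAlt q r.length T (fun c => entryProd x r c)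

variable {q : K} {x : α → β → B}

theorem rowMinor_cons (a : α) (r : List α) (T : Finset β) :
    rowMinor q x (a :: r) T = ∑ j ∈ T, (-q) ^ (T.filter (· < j)).card •
      (x a j * rowMinor q x r (T.erase j)) := by
  simp only [rowMinor, List.length_cons, qAlt_succ, entryProd]
  refine Finset.sum_congr rfl fun j _ => ?_
  congr 1
  exact (qAlt_map (LinearMap.mulLeft K (x a j)) _ _ _).symm

theorem rowMinor_append_congr {r r' : List α} {e : K}
    (h : ∀ T : Finset β, rowMinor q x r T = e • rowMinor q x r' T) (u : List α) (T : Finset β) :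
    rowMinor q x (u ++ r) T = e • rowMinor q x (u ++ r') T := by
  induction u generalizing T with
  | nil => exact h T
  | cons a u ih =>
    simp only [List.cons_append, rowMinor_cons, Finset.smul_sum, ih]
    refine Finset.sum_congr rfl fun j _ => ?_
    rw [mul_smul_comm, smul_comm]

theorem rowMinor_append_singleton (r : List α) (i : α) (T : Finset β)
    (hT : T.card = r.length + 1) :
    rowMinor q x (r ++ [i]) T = ∑ p ∈ T, (-q) ^ (T.filter (p < ·)).card •
      (rowMinor q x r (T.erase p) * x i p) := by
  induction r generalizing T with
  | nil =>
    obtain ⟨p, rfl⟩ := Finset.card_eq_one.1 hT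
    simp [rowMinor, qAlt_succ, qAlt_zero, entryProd, Finset.filter_singleton]
  | cons a r ih =>
    rw [List.cons_append, rowMinor_cons]
    have h1 : ∀ j ∈ T, rowMinor q x (r ++ [i]) (T.erase j) = _ := fun j hj =>
      ih (T.erase j) (by rw [Finset.card_erase_of_mem hj, hT]; rfl)
    rw [Finset.sum_congr rfl fun j hj => by rw [h1 j hj]]
    simp only [rowMinor_cons, Finset.mul_sum, Finset.sum_mul, Finset.smul_sum, mul_smul_comm,
      smul_mul_assoc, smul_smul, ← pow_add]
    rw [Finset.sum_sigma', Finset.sum_sigma']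
    refine Finset.sum_bij' (fun p _ => ⟨p.2, p.1⟩) (fun p _ => ⟨p.2, p.1⟩) ?_ ?_ ?_ ?_ ?_
    · rintro ⟨j, p⟩ h
      simp only [Finset.mem_sigma, Finset.mem_erase] at h ⊢
      exact ⟨h.2.2, h.2.1.symm, h.1⟩
    · rintro ⟨j, p⟩ h
      simp only [Finset.mem_sigma, Finset.mem_erase] at h ⊢
      exact ⟨h.2.2, h.2.1.symm, h.1⟩
    · rintro ⟨j, p⟩ _
      rfl
    · rintro ⟨j, p⟩ _
      rfl
    · rintro ⟨j, p⟩ h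
      simp only [Finset.mem_sigma, Finset.mem_erase] at h
      dsimp only
      rw [Finset.erase_right_comm, mul_assoc]
      congr 2
      rcases lt_or_gt_of_ne h.2.1 with hpj | hpj
      · have h1 := card_filter_erase_add_one (p < ·) h.1 hpj
        have h2 := card_filter_erase_add_one (· < j) h.2.2 hpj
        omega
      · rw [card_filter_erase_of_not (p < ·) (not_lt.2 hpj.le),
          card_filter_erase_of_not (· < j) (not_lt.2 hpj.le), add_comm]

variable [LinearOrder α]

/-- The entries `x i j` satisfy the defining relations of quantum matrices. -/
structure IsQuantumMatrix (q : K) (x : α → β → B) : Prop where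
  row : ∀ (i : α) (j l : β), j < l → x i j * x i l = q • (x i l * x i j)
  col : ∀ (i k : α) (j : β), i < k → x i j * x k j = q • (x k j * x i j)
  antidiag : ∀ (i k : α) (j l : β), k < i → j < l → x i j * x k l = x k l * x i j
  diag : ∀ (i k : α) (j l : β), i < k → j < l →
    x i j * x k l = x k l * x i j + (q - q⁻¹) • (x i l * x k j)

theorem IsQuantumMatrix.flip (hx : IsQuantumMatrix q x) :
    IsQuantumMatrix q (fun j i => x i j) where
  row i j l h := hx.col j l i h
  col i k j h := hx.row j i k h
  antidiag i k j l h h' := (hx.antidiag l j k i h' h).symm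
  diag i k j l h h' := by
    rw [hx.diag j l i k h' h, hx.antidiag l j i k h' h]

theorem IsQuantumMatrix.rowMinor_swap (hx : IsQuantumMatrix q x) (hq : q ≠ 0) {i k : α}
    (hik : i < k) (r : List α) (T : Finset β) :
    rowMinor q x (k :: i :: r) T = (-q) • rowMinor q x (i :: k :: r) T := by
  rw [neg_smul, eq_neg_iff_add_eq_zero]
  simp only [rowMinor, List.length_cons]
  rw [← map_smul, ← map_add]
  refine qAlt_eq_zero_of_head fun a b v hab => ?_
  simp only [Pi.add_apply, Pi.smul_apply, entryProd, ← mul_assoc, ← smul_mul_assoc, ← add_mul]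
  congr 1
  simp only [smul_mul_assoc]
  rw [hx.antidiag k i a b hik hab, hx.diag i k a b hik hab]
  simp only [smul_add, smul_smul]
  have : q * (q - q⁻¹) = q * q - 1 := by field_simp
  rw [this]
  module

theorem IsQuantumMatrix.rowMinor_head_eq (hx : IsQuantumMatrix q x) (i : α) (r : List α)
    (T : Finset β) : rowMinor q x (i :: i :: r) T = 0 := by
  refine qAlt_eq_zero_of_head fun a b v hab => ?_
  simp only [entryProd, ← mul_assoc]
  rw [hx.row i a b hab, smul_mul_assoc]

theorem IsQuantumMatrix.rowMinor_orderedInsert (hx : IsQuantumMatrix q x) (hq : q ≠ 0) (a : α)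
    (s v : List α) (hs : s.Pairwise (· ≤ ·)) (T : Finset β) :
    rowMinor q x (a :: (s ++ v)) T =
      (-q) ^ s.countP (· < a) • rowMinor q x (s.orderedInsert (· ≤ ·) a ++ v) T := by
  induction s generalizing T with
  | nil => simp
  | cons b s ih =>
    rw [List.orderedInsert]
    have hs' := List.pairwise_cons.1 hs
    split_ifs with h
    · have : (b :: s).countP (· < a) = 0 := by
        rw [List.countP_eq_zero]
        intro c hc
        rcases List.mem_cons.1 hc with rfl | hc
        · simpa using h
        · simpa using h.trans (hs'.1 c hc)
      rw [this, pow_zero, one_smul]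
      rfl
    · have hba := not_le.1 h
      have htail := rowMinor_append_congr (ih hs'.2) [b] T
      rw [List.singleton_append] at htail
      rw [List.cons_append, hx.rowMinor_swap hq hba, htail, smul_smul,
        List.countP_cons_of_pos (by simpa using hba), pow_succ']
      rfl

theorem IsQuantumMatrix.rowMinor_append_of_perm (hx : IsQuantumMatrix q x) (hq : q ≠ 0)
    {l s : List α} (hls : l.Perm s) (hs : s.Pairwise (· ≤ ·)) (v : List α) (T : Finset β) :
    rowMinor q x (l ++ v) T = (-q) ^ listInv l • rowMinor q x (s ++ v) T := by
  have hsort : s = l.insertionSort (· ≤ ·) :=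
    List.Perm.eq_of_pairwise (le := (· ≤ ·)) (fun a b _ _ => le_antisymm) hs
      (List.pairwise_insertionSort _ _) (hls.symm.trans (List.perm_insertionSort _ _).symm)
  subst hsort
  clear hls hs
  induction l generalizing T with
  | nil => simp [listInv]
  | cons a l ih =>
    have htail := rowMinor_append_congr ih [a] T
    rw [List.singleton_append, List.singleton_append] at htail
    rw [List.cons_append, htail,
      hx.rowMinor_orderedInsert hq _ _ _ (List.pairwise_insertionSort _ _), smul_smul,
      ← pow_add, listInv, (List.perm_insertionSort (· ≤ ·) l).countP_eq, add_comm]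
    rfl

theorem IsQuantumMatrix.rowMinor_eq_zero (hx : IsQuantumMatrix q x) (hq : q ≠ 0) {l : List α}
    (hl : ¬ l.Nodup) (T : Finset β) : rowMinor q x l T = 0 := by
  have h1 := hx.rowMinor_append_of_perm hq (List.perm_insertionSort (· ≤ ·) l).symm
    (List.pairwise_insertionSort _ _) [] T
  rw [List.append_nil, List.append_nil] at h1
  rw [h1]
  rw [← (List.perm_insertionSort (· ≤ ·) l).nodup_iff] at hl
  have hs := List.pairwise_insertionSort (· ≤ ·) l
  generalize l.insertionSort (· ≤ ·) = s at hl hs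
  clear h1
  suffices h : ∀ T : Finset β, rowMinor q x s T = 0 by rw [h, smul_zero]
  induction s with
  | nil => simp at hl
  | cons a s ih =>
    intro T
    have hs' := List.pairwise_cons.1 hs
    by_cases hnd : s.Nodup
    · have has : a ∈ s := by
        by_contra h
        exact hl (List.nodup_cons.2 ⟨h, hnd⟩)
      cases s with
      | nil => simp at has
      | cons b s =>
        have hba : b ≤ a := by
          rcases List.mem_cons.1 has with rfl | h
          · exact le_rfl
          · exact (List.pairwise_cons.1 hs'.2).1 a h
        obtain rfl := le_antisymm (hs'.1 b (by simp)) hba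
        exact hx.rowMinor_head_eq a s T
    · rw [rowMinor_cons]
      refine Finset.sum_eq_zero fun j _ => ?_
      rw [ih hnd hs'.2, mul_zero, smul_zero]

/-- Row and column expansions of a quantum minor agree. -/
theorem IsQuantumMatrix.rowMinor_eq_flip (hx : IsQuantumMatrix q x) (hq : q ≠ 0)
    (hroot : ∀ s : ℕ, 0 < s → q ^ s ≠ 1) {r : List α} {c : List β} (hr : r.Pairwise (· < ·))
    (hc : c.Pairwise (· < ·)) (hrc : r.length = c.length) :
    rowMinor q x r c.toFinset = rowMinor q (fun j i => x i j) c r.toFinset := by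
  have hrn : r.Nodup := hr.imp fun h => h.ne
  have hcn : c.Nodup := hc.imp fun h => h.ne
  have hrk := List.toFinset_card_of_nodup hrn
  have hck := List.toFinset_card_of_nodup hcn
  have key := qAlt_comm (q := q) r.length c.length r.toFinset c.toFinset (entryProd x)
  rw [qAlt_congr (G := fun r' => (-q) ^ listInv r' • rowMinor q x r c.toFinset),
    qAlt_congr (k := c.length)
      (G := fun c' => (-q) ^ listInv c' • rowMinor q (fun j i => x i j) c r.toFinset),
    qAlt_listInv _ _ hrk, qAlt_listInv _ _ hck, hrc] at key
  · exact smul_right_injective _ (qFact_ne_zero hroot _) key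
  · intro c' hlen hnd hmem
    have hp : c'.Perm c := List.perm_of_nodup_nodup_toFinset_eq hnd hcn
      (toFinset_eq_of_arrangement (hlen.trans hck.symm) hnd hmem)
    have := hx.flip.rowMinor_append_of_perm hq hp (hc.imp le_of_lt) [] r.toFinset
    rw [List.append_nil, List.append_nil] at this
    rw [← this, rowMinor, hlen, hrc]
    simp only [entryProd_flip]
  · intro r' hlen hnd hmem
    have hp : r'.Perm r := List.perm_of_nodup_nodup_toFinset_eq hnd hrn
      (toFinset_eq_of_arrangement (hlen.trans hrk.symm) hnd hmem)
    have := hx.rowMinor_append_of_perm hq hp (hr.imp le_of_lt) [] c.toFinset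
    rw [List.append_nil, List.append_nil] at this
    rw [← this, rowMinor, hlen, hrc]

end QuantumMinors

section MaximalMinors

variable {K : Type*} [Field K] {B : Type*} [Ring B] [Algebra K B] {m n : ℕ}

/-- The maximal quantum minor with columns listed in `c` (in this order), expanded along
columns. -/
def colMinor (q : K) (x : Fin m → Fin n → B) (c : List (Fin n)) : B :=
  rowMinor q (fun j i => x i j) c Finset.univ

/-- The maximal quantum minor on the set of columns `T`, expanded along rows. -/
def setMinor (q : K) (x : Fin m → Fin n → B) (T : Finset (Fin n)) : B :=
  rowMinor q x (List.finRange m) T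

variable {q : K} {x : Fin m → Fin n → B}

theorem listInv_eq_zero {γ : Type*} [LinearOrder γ] {l : List γ} (hl : l.Pairwise (· ≤ ·)) :
    listInv l = 0 := by
  induction l with
  | nil => rfl
  | cons a l ih =>
    have h := List.pairwise_cons.1 hl
    rw [listInv, ih h.2, add_zero, List.countP_eq_zero]
    simpa using h.1

theorem listInv_append_singleton {γ : Type*} [LinearOrder γ] (l : List γ) (a : γ) :
    listInv (l ++ [a]) = listInv l + l.countP (a < ·) := by
  induction l with
  | nil => rfl
  | cons b l ih =>
    simp only [List.cons_append, listInv, ih, List.countP_append, List.countP_cons,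
      List.countP_nil]
    ring

theorem colMinor_eq_qAlt {c : List (Fin n)} (hc : c.length = m) :
    colMinor q x c = qAlt q m Finset.univ (fun r => entryProd x r c) := by
  simp only [colMinor, rowMinor, hc, entryProd_flip]

theorem IsQuantumMatrix.colMinor_sort (hx : IsQuantumMatrix q x) (hq : q ≠ 0)
    (hroot : ∀ s : ℕ, 0 < s → q ^ s ≠ 1) {T : Finset (Fin n)} (hT : T.card = m) :
    colMinor q x (T.sort (· ≤ ·)) = setMinor q x T := by
  have h := hx.rowMinor_eq_flip hq hroot (List.pairwise_lt_finRange m) T.sortedLT_sort.pairwise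
    (by simp [hT])
  rw [Finset.sort_toFinset, List.toFinset_finRange] at h
  exact h.symm

theorem IsQuantumMatrix.colMinor_eq_smul (hx : IsQuantumMatrix q x) (hq : q ≠ 0)
    (hroot : ∀ s : ℕ, 0 < s → q ^ s ≠ 1) {c : List (Fin n)} (hc : c.length = m) (hnd : c.Nodup) :
    colMinor q x c = (-q) ^ listInv c • setMinor q x c.toFinset := by
  have hp : c.Perm (c.toFinset.sort (· ≤ ·)) :=
    List.perm_of_nodup_nodup_toFinset_eq hnd (Finset.sort_nodup _ _) (by simp)
  have h := hx.flip.rowMinor_append_of_perm hq hp (Finset.pairwise_sort _ _) [] Finset.univ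
  rw [List.append_nil, List.append_nil] at h
  rw [← hx.colMinor_sort hq hroot (by rw [List.toFinset_card_of_nodup hnd, hc])]
  exact h

theorem IsQuantumMatrix.colMinor_eq_zero (hx : IsQuantumMatrix q x) (hq : q ≠ 0)
    {c : List (Fin n)} (hnd : ¬ c.Nodup) : colMinor q x c = 0 :=
  hx.flip.rowMinor_eq_zero hq hnd _

/-- Moving an entry past a maximal minor. -/
theorem IsQuantumMatrix.entry_mul_setMinor (hx : IsQuantumMatrix q x) (hq : q ≠ 0)
    (hroot : ∀ s : ℕ, 0 < s → q ^ s ≠ 1) (i : Fin m) (s : Fin n) {T : Finset (Fin n)}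
    (hT : T.card = m) :
    (-q) ^ (m - 1) • (x i s * setMinor q x T) =
      ∑ p ∈ T, (-q) ^ (T.filter (p < ·)).card •
        (colMinor q x (s :: (T.erase p).sort (· ≤ ·)) * x i p) := by
  have hflip : ∀ p ∈ T, ∀ r : Fin m,
      rowMinor q (fun j i => x i j) ((T.erase p).sort (· ≤ ·)) (Finset.univ.erase r) =
        rowMinor q x ((Finset.univ.erase r).sort (· ≤ ·)) (T.erase p) := by
    intro p hp r
    have h := hx.rowMinor_eq_flip hq hroot (Finset.univ.erase r).sortedLT_sort.pairwise
      (T.erase p).sortedLT_sort.pairwise (by simp [Finset.card_erase_of_mem hp, hT])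
    rw [Finset.sort_toFinset, Finset.sort_toFinset] at h
    exact h.symm
  have hm : 0 < m := i.pos
  have hrow : ∀ r : Fin m, rowMinor q x ((Finset.univ.erase r).sort (· ≤ ·) ++ [i]) T =
      ∑ p ∈ T, (-q) ^ (T.filter (p < ·)).card •
        (rowMinor q x ((Finset.univ.erase r).sort (· ≤ ·)) (T.erase p) * x i p) := fun r =>
    rowMinor_append_singleton _ _ _ (by simp [hT]; omega)
  have hRHS : ∑ p ∈ T, (-q) ^ (T.filter (p < ·)).card •
      (colMinor q x (s :: (T.erase p).sort (· ≤ ·)) * x i p) =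
      ∑ r : Fin m, (-q) ^ (Finset.univ.filter (· < r)).card •
        (x r s * rowMinor q x ((Finset.univ.erase r).sort (· ≤ ·) ++ [i]) T) := by
    simp only [hrow, Finset.mul_sum, Finset.smul_sum]
    rw [Finset.sum_comm]
    refine Finset.sum_congr rfl fun p hp => ?_
    rw [colMinor, rowMinor_cons, Finset.sum_mul, Finset.smul_sum]
    refine Finset.sum_congr rfl fun r _ => ?_
    rw [hflip p hp r, mul_smul_comm, smul_mul_assoc, smul_comm, mul_assoc]
  rw [hRHS, Finset.sum_eq_single i]
  · have hp : ((Finset.univ.erase i).sort (· ≤ ·) ++ [i]).Perm (List.finRange m) := by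
      refine List.perm_of_nodup_nodup_toFinset_eq ?_ (List.nodup_finRange m) ?_
      · rw [List.nodup_append]
        simp
      · ext a
        simp
    have h := hx.rowMinor_append_of_perm hq hp
      ((List.pairwise_lt_finRange m).imp le_of_lt) [] T
    rw [List.append_nil, List.append_nil] at h
    rw [h, mul_smul_comm, smul_smul, ← pow_add, setMinor, listInv_append_singleton,
      listInv_eq_zero (Finset.pairwise_sort _ _), zero_add,
      countP_eq_card_filter (Finset.sort_nodup _ _) (Finset.sort_toFinset _ _) (i < ·),
      card_filter_erase_of_not (i < ·) (lt_irrefl i)]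
    congr 2
    have h1 : (Finset.univ.filter (· < i)).card = i := by
      rw [Finset.filter_gt_eq_Iio, Fin.card_Iio]
    have h2 : (Finset.univ.filter (i < ·)).card = m - 1 - i := by
      rw [Finset.filter_lt_eq_Ioi, Fin.card_Ioi]
    omega
  · intro r _ hri
    rw [hx.rowMinor_eq_zero hq, mul_zero, smul_zero]
    rw [List.nodup_append]
    simp [hri.symm]
  · simp

/-- The quantum Plücker relations. -/
theorem IsQuantumMatrix.qAlt_colMinor_mul_colMinor (hx : IsQuantumMatrix q x) (hq : q ≠ 0)
    {k t : ℕ} (hk : m < k) (ht : t ≤ k) (u v : List (Fin n)) (hu : u.length + t = m)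
    (hv : (k - t) + v.length = m) (T : Finset (Fin n)) :
    qAlt q k T (fun c => colMinor q x (u ++ c.take t) * colMinor q x (c.drop t ++ v)) = 0 := by
  have h1 : qAlt q k T (fun c => colMinor q x (u ++ c.take t) * colMinor q x (c.drop t ++ v)) =
      qAlt q k T (fun c => qAlt q m Finset.univ fun r => qAlt q m Finset.univ fun r' =>
        entryProd x r (u ++ c.take t) * entryProd x r' (c.drop t ++ v)) := by
    refine qAlt_congr fun c hlen _ _ => ?_
    rw [colMinor_eq_qAlt (c := u ++ c.take t) (by simp [hlen]; omega),
      colMinor_eq_qAlt (c := c.drop t ++ v) (by simp [hlen]; omega)]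
    rw [← LinearMap.mulRight_apply (R := K), qAlt_map]
    simp only [LinearMap.mulRight_apply]
    congr 1
    ext r
    exact qAlt_map (LinearMap.mulLeft K (entryProd x r (u ++ c.take t))) _ _ _
  rw [h1, qAlt_comm]
  rw [qAlt_congr (G := fun _ => 0)]
  · exact map_zero _
  intro r hr _ _
  rw [qAlt_comm, qAlt_congr (G := fun _ => 0)]
  · exact map_zero _
  intro r' hr' _ _
  rw [qAlt_congr (G := fun c => (LinearMap.mulLeft K (entryProd x (r.take u.length) u) ∘ₗ
      LinearMap.mulRight K (entryProd x (r'.drop (k - t)) v))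
        (entryProd x (r.drop u.length ++ r'.take (k - t)) c)), ← qAlt_map]
  · have hlen : (r.drop u.length ++ r'.take (k - t)).length = k := by
      simp [hr, hr']; omega
    have h0 := hx.rowMinor_eq_zero hq (l := r.drop u.length ++ r'.take (k - t)) (fun hnd => by
      have := hnd.length_le_card
      rw [hlen, Fintype.card_fin] at this
      omega) T
    rw [rowMinor, hlen] at h0
    rw [h0, map_zero]
  · intro c hlen _ _
    have e1 := entryProd_append x (r.take u.length) (r.drop u.length) u (c.take t)
      (by simp; omega)
    have e2 := entryProd_append x (r'.take (k - t)) (r'.drop (k - t)) (c.drop t) v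
      (by simp [hlen]; omega)
    have e3 := entryProd_append x (r.drop u.length) (r'.take (k - t)) (c.take t) (c.drop t)
      (by simp [hlen]; omega)
    rw [List.take_append_drop] at e1 e2 e3
    simp only [LinearMap.comp_apply, LinearMap.mulLeft_apply, LinearMap.mulRight_apply, e1, e2,
      e3, mul_assoc]

end MaximalMinors

section Exchange

variable {K : Type*} [Field K] {B : Type*} [Ring B] [Algebra K B] {m n : ℕ}

theorem map_mem_of_mem_span {V W : Type*} [AddCommGroup V] [Module K V] [AddCommGroup W]
    [Module K W] {s : Set V} (φ : V →ₗ[K] W) {N : Submodule K W} (h : ∀ w ∈ s, φ w ∈ N) {v : V}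
    (hv : v ∈ Submodule.span K s) : φ v ∈ N :=
  (Submodule.span_le.2 h : Submodule.span K s ≤ N.comap φ) hv

/-- The set of columns of a column index. -/
def colSet (J : Fin m ↪o Fin n) : Finset (Fin n) := Finset.univ.map J.toEmbedding

theorem card_colSet (J : Fin m ↪o Fin n) : (colSet J).card = m := by simp [colSet]

theorem exists_colSet_eq {T : Finset (Fin n)} (hT : T.card = m) :
    ∃ J : Fin m ↪o Fin n, colSet J = T :=
  ⟨T.orderEmbOfFin hT, T.map_orderEmbOfFin_univ hT⟩

theorem toFinset_ofFn_eq_colSet (J : Fin m ↪o Fin n) : (List.ofFn J).toFinset = colSet J := by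
  ext a
  simp [colSet, List.mem_ofFn]

theorem le_of_card_filter_colSet_le {I J : Fin m ↪o Fin n}
    (h : ∀ y, ((colSet I).filter (y < ·)).card ≤ ((colSet J).filter (y < ·)).card) : I ≤ J := by
  have hcard : ∀ (L : Fin m ↪o Fin n) (y : Fin n), ((colSet L).filter (y < ·)).card =
      (Finset.univ.filter fun k => y < L k).card := by
    intro L y
    rw [colSet, Finset.filter_map, Finset.card_map]
    rfl
  intro k
  by_contra hk
  have hk : J k < I k := not_le.1 hk
  have h1 := h (J k)
  rw [hcard, hcard] at h1
  have h2 : Finset.Ici k ⊆ Finset.univ.filter fun l => J k < I l := by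
    intro l hl
    simpa using hk.trans_le (I.monotone (Finset.mem_Ici.1 hl))
  have h3 : (Finset.univ.filter fun l => J k < J l) = Finset.Ioi k := by
    ext l
    simp
  have h4 := Finset.card_le_card h2
  rw [h3, Fin.card_Ioi] at h1
  rw [Fin.card_Ici] at h4
  omega

theorem card_filter_insert_erase_le {T : Finset (Fin n)} {s p : Fin n} (hp : p ∈ T) (hsp : s ≤ p)
    (y : Fin n) :
    ((insert s (T.erase p)).filter (y < ·)).card ≤ (T.filter (y < ·)).card := by
  rw [Finset.filter_insert]
  split_ifs with h
  · refine (Finset.card_insert_le _ _).trans (le_of_eq ?_)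
    exact card_filter_erase_add_one (y < ·) hp (h.trans_le hsp)
  · exact Finset.card_le_card (Finset.filter_subset_filter _ (Finset.erase_subset _ _))

variable {q : K} {x : Fin m → Fin n → B}

theorem IsQuantumMatrix.colMinor_ofFn (hx : IsQuantumMatrix q x) (hq : q ≠ 0)
    (hroot : ∀ s : ℕ, 0 < s → q ^ s ≠ 1) (J : Fin m ↪o Fin n) :
    colMinor q x (List.ofFn J) = setMinor q x (colSet J) := by
  rw [hx.colMinor_eq_smul hq hroot (by simp) (List.nodup_ofFn.2 J.injective),
    listInv_eq_zero, pow_zero, one_smul, toFinset_ofFn_eq_colSet]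
  exact List.pairwise_ofFn.2 fun i j hij => J.monotone hij.le

theorem IsQuantumMatrix.colMinor_eq_zero_or (hx : IsQuantumMatrix q x) (hq : q ≠ 0)
    (hroot : ∀ s : ℕ, 0 < s → q ^ s ≠ 1) {c : List (Fin n)} (hc : c.length = m) :
    colMinor q x c = 0 ∨ ∃ (e : K) (J : Fin m ↪o Fin n), c.Nodup ∧ colSet J = c.toFinset ∧
      colMinor q x c = e • setMinor q x (colSet J) := by
  by_cases hnd : c.Nodup
  · right
    obtain ⟨J, hJ⟩ := exists_colSet_eq
      (show c.toFinset.card = m by rw [List.toFinset_card_of_nodup hnd, hc])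
    exact ⟨_, J, hnd, hJ, by rw [hJ]; exact hx.colMinor_eq_smul hq hroot hc hnd⟩
  · exact Or.inl (hx.colMinor_eq_zero hq hnd)

theorem setMinor_mul_entry_mem_span {J : Fin m ↪o Fin n} {s p : Fin n} (hp : p ∈ colSet J)
    (hsp : s ≤ p) (hcard : (insert s ((colSet J).erase p)).card = m) :
    (fun i => setMinor q x (insert s ((colSet J).erase p)) * x i p) ∈
      Submodule.span K {g : Fin m → B | ∃ J' : Fin m ↪o Fin n, J' ≤ J ∧
        ∃ p, g = fun i => setMinor q x (colSet J') * x i p} := by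
  obtain ⟨J', hJ'⟩ := exists_colSet_eq hcard
  refine Submodule.subset_span ⟨J', le_of_card_filter_colSet_le fun y => ?_, p, by rw [hJ']⟩
  rw [hJ']
  exact card_filter_insert_erase_le hp hsp y

theorem IsQuantumMatrix.entry_mul_setMinor_mem_span (hx : IsQuantumMatrix q x) (hq : q ≠ 0)
    (hroot : ∀ s : ℕ, 0 < s → q ^ s ≠ 1) (s : Fin n) (J : Fin m ↪o Fin n) :
    (fun i => x i s * setMinor q x (colSet J)) ∈
      Submodule.span K {g : Fin m → B | ∃ J' : Fin m ↪o Fin n, J' ≤ J ∧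
        ∃ p, g = fun i => setMinor q x (colSet J') * x i p} := by
  set N := Submodule.span K {g : Fin m → B | ∃ J' : Fin m ↪o Fin n, J' ≤ J ∧
        ∃ p, g = fun i => setMinor q x (colSet J') * x i p} with hN
  have hq' : -q ≠ 0 := neg_ne_zero.2 hq
  have hT := card_colSet J
  rw [← N.smul_mem_iff (pow_ne_zero (m - 1) hq')]
  have hmain : (-q) ^ (m - 1) • (fun i => x i s * setMinor q x (colSet J)) =
      ∑ p ∈ colSet J, (-q) ^ ((colSet J).filter (p < ·)).card •
        fun i => colMinor q x (s :: ((colSet J).erase p).sort (· ≤ ·)) * x i p := by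
    ext i
    simpa using hx.entry_mul_setMinor hq hroot i s hT
  rw [hmain]
  have hcol : ∀ p ∈ colSet J, s ∉ (colSet J).erase p →
      (insert s ((colSet J).erase p)).card = m ∧
      colMinor q x (s :: ((colSet J).erase p).sort (· ≤ ·)) =
        (-q) ^ (((colSet J).erase p).filter (· < s)).card •
          setMinor q x (insert s ((colSet J).erase p)) := by
    intro p hp hs
    have hcard : (insert s ((colSet J).erase p)).card = m := by
      rw [Finset.card_insert_of_notMem hs, Finset.card_erase_add_one hp, hT]
    refine ⟨hcard, ?_⟩
    rw [hx.colMinor_eq_smul hq hroot, listInv, listInv_eq_zero (Finset.pairwise_sort _ _),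
      countP_eq_card_filter (Finset.sort_nodup _ _) (Finset.sort_toFinset _ _) (· < s), add_zero,
      List.toFinset_cons, Finset.sort_toFinset]
    · rw [List.length_cons, Finset.length_sort, Finset.card_erase_add_one hp, hT]
    · exact List.nodup_cons.2 ⟨by simpa using hs, Finset.sort_nodup _ _⟩
  by_cases hs : s ∈ colSet J
  · refine N.sum_mem fun p hp => N.smul_mem _ ?_
    by_cases hps : p = s
    · subst hps
      obtain ⟨h1, h2⟩ := hcol p hp (Finset.notMem_erase _ _)
      simp only [h2, smul_mul_assoc]
      exact N.smul_mem _ (setMinor_mul_entry_mem_span hp le_rfl h1)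
    · have h0 : colMinor q x (s :: ((colSet J).erase p).sort (· ≤ ·)) = 0 := by
        refine hx.colMinor_eq_zero hq fun hnd => ?_
        have := (List.nodup_cons.1 hnd).1
        simp [hs, Ne.symm hps] at this
      simp only [h0, zero_mul]
      exact N.zero_mem
  · have hcol' := fun p hp => hcol p hp fun h => hs (Finset.mem_of_mem_erase h)
    have hplucker : (-q) ^ ((colSet J).filter (s < ·)).card •
          (fun i => setMinor q x (colSet J) * x i s) +
        ∑ p ∈ colSet J, (-q) ^ (((colSet J).filter (p < ·)).card + if p < s then 1 else 0) •
          (fun i => setMinor q x (insert s ((colSet J).erase p)) * x i p) = 0 := by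
      ext i
      have h := rowMinor_append_singleton (q := q) (x := x) (List.finRange m) i
        (insert s (colSet J)) (by simp [hs, hT])
      rw [hx.rowMinor_eq_zero hq (by simp [List.nodup_append]), Finset.sum_insert hs,
        Finset.erase_insert hs, Finset.filter_insert, if_neg (lt_irrefl s)] at h
      simp only [Pi.add_apply, Pi.smul_apply, Finset.sum_apply, Pi.zero_apply]
      rw [h]
      congr 1
      refine Finset.sum_congr rfl fun p hp => ?_
      have hps : s ≠ p := fun h => hs (h ▸ hp)
      rw [Finset.erase_insert_of_ne hps, setMinor, Finset.filter_insert]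
      split_ifs
      · rw [Finset.card_insert_of_notMem (by simp [hs])]
      · rfl
    set E : K := (-q) ^ ((colSet J).filter (· < s)).card * ((-q) ^ 2)⁻¹ with hE
    rw [← sub_zero (Finset.sum _ _), ← smul_zero E, ← hplucker, smul_add, Finset.smul_sum,
      sub_add_eq_sub_sub, sub_right_comm, ← Finset.sum_sub_distrib]
    refine N.sub_mem (N.sum_mem fun p hp => ?_)
      (N.smul_mem _ (N.smul_mem _ (Submodule.subset_span ⟨J, le_rfl, s, rfl⟩)))
    simp only [(hcol' p hp).2, smul_mul_assoc]
    have hps : p ≠ s := fun h => hs (h ▸ hp)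
    rcases lt_or_gt_of_ne hps with hlt | hgt
    · convert N.zero_mem using 1
      rw [sub_eq_zero, if_pos hlt, hE, ← card_filter_erase_add_one (· < s) hp hlt, smul_smul]
      ext i
      simp only [Pi.smul_apply, smul_smul]
      congr 1
      field_simp
      ring
    · have := setMinor_mul_entry_mem_span (q := q) (x := x) hp hgt.le (hcol' p hp).1
      exact N.sub_mem (N.smul_mem _ (N.smul_mem _ this)) (N.smul_mem _ (N.smul_mem _ this))

theorem IsQuantumMatrix.entryProd_mul_setMinor_mem_span (hx : IsQuantumMatrix q x) (hq : q ≠ 0)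
    (hroot : ∀ s : ℕ, 0 < s → q ^ s ≠ 1) (a : List (Fin n)) (J : Fin m ↪o Fin n) :
    (fun r => entryProd x r a * setMinor q x (colSet J)) ∈
      Submodule.span K {g : List (Fin m) → B | ∃ J' : Fin m ↪o Fin n, J' ≤ J ∧
        ∃ a' : List (Fin n), a'.length = a.length ∧
          g = fun r => setMinor q x (colSet J') * entryProd x r a'} := by
  induction a with
  | nil =>
    refine Submodule.subset_span ⟨J, le_rfl, [], rfl, ?_⟩
    ext r
    cases r <;> simp [entryProd]
  | cons b a ih =>
    set N := Submodule.span K {g : List (Fin m) → B | ∃ J' : Fin m ↪o Fin n, J' ≤ J ∧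
        ∃ a' : List (Fin n), a'.length = (b :: a).length ∧
          g = fun r => setMinor q x (colSet J') * entryProd x r a'} with hN
    let φ : (List (Fin m) → B) →ₗ[K] (List (Fin m) → B) := LinearMap.pi fun r =>
      match r with
      | [] => 0
      | i :: r => LinearMap.mulLeft K (x i b) ∘ₗ LinearMap.proj r
    have h1 := map_mem_of_mem_span φ (N := N) ?_ ih
    · convert h1 using 1
      ext r
      cases r <;> simp [entryProd, φ, mul_assoc]
    · rintro _ ⟨J', hJ', a', ha', rfl⟩
      let ψ : (Fin m → B) →ₗ[K] (List (Fin m) → B) := LinearMap.pi fun r =>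
        match r with
        | [] => 0
        | i :: r => LinearMap.mulRight K (entryProd x r a') ∘ₗ LinearMap.proj i
      have h2 := map_mem_of_mem_span ψ (N := N) ?_
        (hx.entry_mul_setMinor_mem_span hq hroot b J')
      · convert h2 using 1
        ext r
        cases r <;> simp [φ, ψ, mul_assoc]
      · rintro _ ⟨J'', hJ'', p, rfl⟩
        refine Submodule.subset_span ⟨J'', hJ''.trans hJ', p :: a', by simp [ha'], ?_⟩
        ext r
        cases r <;> simp [entryProd, ψ, mul_assoc]

/-- A product of maximal minors rewritten with the factors interchanged, up to lower terms. -/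
theorem IsQuantumMatrix.setMinor_mul_mem_span_swap (hx : IsQuantumMatrix q x) (hq : q ≠ 0)
    (hroot : ∀ s : ℕ, 0 < s → q ^ s ≠ 1) (I J : Fin m ↪o Fin n) :
    setMinor q x (colSet I) * setMinor q x (colSet J) ∈
      Submodule.span K {b : B | ∃ J' I' : Fin m ↪o Fin n, J' ≤ J ∧
        b = setMinor q x (colSet J') * setMinor q x (colSet I')} := by
  set N := Submodule.span K {b : B | ∃ J' I' : Fin m ↪o Fin n, J' ≤ J ∧
        b = setMinor q x (colSet J') * setMinor q x (colSet I')} with hN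
  have h1 := map_mem_of_mem_span (qAlt q m (Finset.univ : Finset (Fin m))) (N := N) ?_
    (hx.entryProd_mul_setMinor_mem_span hq hroot (List.ofFn I) J)
  · rw [← hx.colMinor_ofFn hq hroot I, colMinor_eq_qAlt (by simp),
      ← LinearMap.mulRight_apply (R := K), qAlt_map]
    exact h1
  · rintro _ ⟨J', hJ', a, ha, rfl⟩
    rw [List.length_ofFn] at ha
    have h3 := qAlt_map (q := q) (LinearMap.mulLeft K (setMinor q x (colSet J'))) m Finset.univ
      (fun r => entryProd x r a)
    simp only [LinearMap.mulLeft_apply] at h3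
    rw [← h3, ← colMinor_eq_qAlt ha]
    rcases hx.colMinor_eq_zero_or hq hroot ha with h0 | ⟨e, I', -, -, h⟩
    · rw [h0, mul_zero]
      exact N.zero_mem
    · rw [h, mul_smul_comm]
      exact N.smul_mem _ (Submodule.subset_span ⟨J', I', hJ', rfl⟩)

end Exchange

section Straightening

variable {K : Type*} [Field K] {B : Type*} [Ring B] [Algebra K B] {m n : ℕ}
  {q : K} {x : Fin m → Fin n → B}

theorem IsQuantumMatrix.colMinor_append_of_perm (hx : IsQuantumMatrix q x) (hq : q ≠ 0)
    (u : List (Fin n)) {l s : List (Fin n)} (hls : l.Perm s) (hs : s.Pairwise (· ≤ ·)) :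
    colMinor q x (u ++ l) = (-q) ^ listInv l • colMinor q x (u ++ s) := by
  refine rowMinor_append_congr (fun T => ?_) u _
  simpa using hx.flip.rowMinor_append_of_perm hq hls hs [] T

theorem card_filter_lt_le_of_subset_union {L U C : Finset (Fin n)}
    (hLU : ∀ l ∈ L, ∀ u ∈ U, l < u) (hC : C ⊆ L ∪ U) (hcard : C.card ≤ U.card) (y : Fin n) :
    (C.filter (y < ·)).card ≤ (U.filter (y < ·)).card := by
  by_cases h : ∀ w ∈ U, y < w
  · rw [Finset.filter_true_of_mem h]
    exact (Finset.card_filter_le _ _).trans hcard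
  · push Not at h
    obtain ⟨w, hw, hwy⟩ := h
    refine Finset.card_le_card fun c hc => ?_
    obtain ⟨hcC, hyc⟩ := Finset.mem_filter.1 hc
    refine Finset.mem_filter.2 ⟨(Finset.mem_union.1 (hC hcC)).resolve_left fun hcL => ?_, hyc⟩
    exact absurd (hLU c hcL w hw) (not_lt.2 (hwy.trans hyc.le))

/-- Replacing final columns `U` of a column index by columns from `L ∪ U`, at least one of them
in `L`, where `L` lies to the left of `U`, yields a smaller column index. -/
theorem lt_of_colSet_eq_append {I I' : Fin m ↪o Fin n} {L U : Finset (Fin n)} {u s c : List (Fin n)}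
    (hus : u ++ s = List.ofFn I) (hU : s.toFinset = U) (hLU : ∀ l ∈ L, ∀ u ∈ U, l < u)
    (hlen : c.length = s.length) (hcLU : ∀ b ∈ c, b ∈ L ∪ U) (hcL : ∃ l ∈ c, l ∈ L)
    (hnd : (u ++ c).Nodup) (hI' : colSet I' = (u ++ c).toFinset) : I' < I := by
  have hI : colSet I = u.toFinset ∪ U := by
    rw [← toFinset_ofFn_eq_colSet, ← hus, List.toFinset_append, hU]
  have hnd' : (u ++ s).Nodup := by rw [hus]; exact List.nodup_ofFn.2 I.injective
  rw [List.nodup_append] at hnd hnd'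
  rw [List.toFinset_append] at hI'
  have hdisj : Disjoint u.toFinset U := by
    rw [Finset.disjoint_left, ← hU]
    intro a h1 h2
    exact hnd'.2.2 a (by simpa using h1) a (by simpa using h2) rfl
  refine lt_of_le_of_ne (le_of_card_filter_colSet_le fun y => ?_) fun h => ?_
  · rw [hI, hI', Finset.filter_union, Finset.filter_union,
      Finset.card_union_of_disjoint (Finset.disjoint_filter_filter hdisj)]
    refine (Finset.card_union_le _ _).trans (Nat.add_le_add_left ?_ _)
    refine card_filter_lt_le_of_subset_union hLU (fun b hb => hcLU b (by simpa using hb)) ?_ y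
    rw [← hU, List.toFinset_card_of_nodup hnd.2.1, List.toFinset_card_of_nodup hnd'.2.1, hlen]
  · obtain ⟨l, hlc, hlL⟩ := hcL
    have hl : l ∈ colSet I := by
      rw [← h, hI']
      simp [hlc]
    rw [hI, Finset.mem_union, List.mem_toFinset] at hl
    rcases hl with hl | hl
    · exact hnd.2.2 l hl l hlc rfl
    · exact lt_irrefl _ (hLU l hlL l hl)

/-- A product of two maximal minors that is not standard is a combination of products whose first
factor is strictly smaller. -/
theorem IsQuantumMatrix.setMinor_mul_mem_span_lt (hx : IsQuantumMatrix q x) (hq : q ≠ 0)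
    (hroot : ∀ s : ℕ, 0 < s → q ^ s ≠ 1) {I J : Fin m ↪o Fin n} (hIJ : ¬ I ≤ J) :
    setMinor q x (colSet I) * setMinor q x (colSet J) ∈
      Submodule.span K {b : B | ∃ I' J' : Fin m ↪o Fin n, I' < I ∧
        b = setMinor q x (colSet I') * setMinor q x (colSet J')} := by
  set N := Submodule.span K {b : B | ∃ I' J' : Fin m ↪o Fin n, I' < I ∧
        b = setMinor q x (colSet I') * setMinor q x (colSet J')} with hN
  obtain ⟨k, hk⟩ : ∃ k, J k < I k := by
    by_contra! h
    exact hIJ h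
  have hsorted : ∀ H : Fin m ↪o Fin n, (List.ofFn H).Pairwise (· < ·) := fun H =>
    List.pairwise_ofFn.2 fun i j hij => H.strictMono hij
  have hkm := k.isLt
  set u := (List.ofFn I).take k with hu
  set s := (List.ofFn I).drop k with hs
  set l := (List.ofFn J).take (k + 1) with hl
  set v := (List.ofFn J).drop (k + 1) with hv
  have hus : u ++ s = List.ofFn I := List.take_append_drop _ _
  have hlv : l ++ v = List.ofFn J := List.take_append_drop _ _
  have hss : s.Pairwise (· < ·) := (hsorted I).drop
  have hls : l.Pairwise (· < ·) := (hsorted J).take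
  have hsnd : s.Nodup := hss.imp fun h => h.ne
  have hlnd : l.Nodup := hls.imp fun h => h.ne
  have hslen : s.length = m - k := by simp [hs]
  have hllen : l.length = k + 1 := by simp [hl]
  have hscard : s.toFinset.card = m - k := by rw [List.toFinset_card_of_nodup hsnd, hslen]
  have hlcard : l.toFinset.card = k + 1 := by rw [List.toFinset_card_of_nodup hlnd, hllen]
  have hulen : u.length = k := by simp [hu]
  have hvlen : v.length = m - (k + 1) := by simp [hv]
  have hlt : ∀ a ∈ l.toFinset, ∀ b ∈ s.toFinset, a < b := by
    intro a ha b hb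
    rw [List.mem_toFinset] at ha hb
    obtain ⟨i, hi, rfl⟩ := List.mem_take_iff_getElem.1 ha
    obtain ⟨j, hj, rfl⟩ := List.mem_drop_iff_getElem.1 hb
    rw [List.getElem_ofFn, List.getElem_ofFn]
    refine (J.monotone (Fin.le_def.2 ?_)).trans_lt (hk.trans_le (I.monotone (Fin.le_def.2 ?_)))
    · simp only
      omega
    · simp
  have hmem := qAlt_union_sub_mem (q := q) N l.toFinset (m - k) s.toFinset hscard hlt
    (fun c => colMinor q x (u ++ c.take (m - k)) * colMinor q x (c.drop (m - k) ++ v)) ?_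
  · rw [hx.qAlt_colMinor_mul_colMinor hq (by omega) (by omega) u v (by omega) (by omega),
      zero_sub, N.neg_mem_iff, N.smul_mem_iff (pow_ne_zero _ (neg_ne_zero.2 hq)),
      qAlt_congr (G := fun c => (-q) ^ listInv c • qFact q (k + 1) •
        (setMinor q x (colSet I) * setMinor q x (colSet J))),
      qAlt_listInv _ _ hscard, N.smul_mem_iff (qFact_ne_zero hroot _),
      N.smul_mem_iff (qFact_ne_zero hroot _)] at hmem
    · exact hmem
    · intro c hclen hcnd hcs
      have hcp : c.Perm s := List.perm_of_nodup_nodup_toFinset_eq hcnd hsnd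
        (toFinset_eq_of_arrangement (hclen.trans hscard.symm) hcnd hcs)
      rw [qAlt_congr (G := fun d => (-q) ^ listInv d • (-q) ^ listInv c •
        (setMinor q x (colSet I) * setMinor q x (colSet J))), qAlt_listInv _ _ rfl, hlcard,
        smul_comm]
      intro d hdlen hdnd hdl
      have hdp : d.Perm l := List.perm_of_nodup_nodup_toFinset_eq hdnd hlnd
        (toFinset_eq_of_arrangement hdlen hdnd hdl)
      rw [List.take_left' hclen, List.drop_left' hclen,
        hx.colMinor_append_of_perm hq u hcp (hss.imp le_of_lt), hus,
        colMinor, colMinor, hx.flip.rowMinor_append_of_perm hq hdp (hls.imp le_of_lt), hlv,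
        ← colMinor, ← colMinor, hx.colMinor_ofFn hq hroot, hx.colMinor_ofFn hq hroot,
        smul_mul_smul_comm, smul_smul, mul_comm]
  · intro c hclen hcnd hc hcL
    have htl : (c.take (m - k)).length = m - k := by rw [List.length_take]; omega
    have h1 := hx.colMinor_eq_zero_or hq hroot (c := u ++ c.take (m - k))
      (by rw [List.length_append]; omega)
    have h2 := hx.colMinor_eq_zero_or hq hroot (c := c.drop (m - k) ++ v)
      (by rw [List.length_append, List.length_drop]; omega)
    rcases h1 with h1 | ⟨e, I', hnd, hI', h1⟩
    · rw [h1, zero_mul]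
      exact N.zero_mem
    rcases h2 with h2 | ⟨e', J', -, -, h2⟩
    · rw [h2, mul_zero]
      exact N.zero_mem
    rw [h1, h2, smul_mul_smul_comm]
    refine N.smul_mem _ (Submodule.subset_span ⟨I', J', ?_, rfl⟩)
    obtain ⟨a, ha, haL⟩ := hcL
    exact lt_of_colSet_eq_append hus rfl hlt (htl.trans hslen.symm)
      (fun b hb => hc b (List.mem_of_mem_take hb)) ⟨a, ha, haL⟩ hnd hI'

end Straightening

section Expansion

variable {K : Type*} [Field K] {V : Type*} [AddCommGroup V] [Module K V] {β : Type*}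
  [LinearOrder β] {q : K}

open Classical in
/-- The alternating sum over all arrangements of `T`, written as a sum over functions. -/
theorem qAlt_eq_sum_fun [Fintype β] {k : ℕ} {T : Finset β} (hT : T.card = k) (F : List β → V) :
    qAlt q k T F = ∑ f : Fin k → β, if Function.Injective f ∧ ∀ i, f i ∈ T then
      (-q) ^ listInv (List.ofFn f) • F (List.ofFn f) else 0 := by
  induction k generalizing T F with
  | zero =>
    rw [Fintype.sum_subsingleton _ ![], if_pos ⟨Function.injective_of_subsingleton _, by simp⟩]
    simp [qAlt_zero, listInv]
  | succ k ih =>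
    rw [← (Fin.consEquiv fun _ => β).sum_comp, Fintype.sum_prod_type, qAlt_succ,
      ← Finset.sum_filter_add_sum_filter_not Finset.univ (· ∈ T),
      Finset.sum_eq_zero (s := Finset.univ.filter fun j => ¬ j ∈ T), add_zero]
    · refine Finset.sum_congr (Finset.filter_univ_mem T).symm fun j hj => ?_
      have hj : j ∈ T := (Finset.mem_filter.1 hj).2
      have hc : (T.erase j).card = k := by rw [Finset.card_erase_of_mem hj, hT]; rfl
      rw [ih hc, Finset.smul_sum]
      refine Finset.sum_congr rfl fun f _ => ?_
      have hiff : (Function.Injective (Fin.consEquiv (fun _ => β) (j, f)) ∧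
          ∀ i, Fin.consEquiv (fun _ => β) (j, f) i ∈ T) ↔
          Function.Injective f ∧ ∀ i, f i ∈ T.erase j := by
        simp only [Fin.consEquiv, Equiv.coe_fn_mk, Fin.cons_injective_iff, Fin.forall_fin_succ,
          Fin.cons_zero, Fin.cons_succ, Finset.mem_erase, Set.mem_range, not_exists, forall_and, hj]
        tauto
      simp only [hiff, smul_ite, smul_zero]
      split_ifs with hf
      · have hnd : (List.ofFn f).Nodup := List.nodup_ofFn.2 hf.1
        have hset : (List.ofFn f).toFinset = T.erase j :=
          toFinset_eq_of_arrangement (by rw [List.length_ofFn, hc]) hnd fun b hb => by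
            obtain ⟨i, rfl⟩ := (List.mem_ofFn' f b).1 hb
            exact hf.2 i
        have hlist : List.ofFn (Fin.consEquiv (fun _ => β) (j, f)) = j :: List.ofFn f := by
          simp [Fin.consEquiv, List.ofFn_succ]
        rw [hlist, listInv, countP_eq_card_filter hnd hset (· < j),
          card_filter_erase_of_not (· < j) (lt_irrefl j), pow_add, mul_smul]
      · rfl
    · intro j hj
      refine Finset.sum_eq_zero fun f _ => if_neg fun h => ?_
      exact (Finset.mem_filter.1 hj).2 (h.2 0)

theorem listInv_ofFn {k : ℕ} (f : Fin k → β) : listInv (List.ofFn f) =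
    (Finset.univ.filter fun p : Fin k × Fin k => p.1 < p.2 ∧ f p.2 < f p.1).card := by
  induction k with
  | zero => simp [listInv]
  | succ k ih =>
    have hcount : ∀ (l : ℕ) (g : Fin l → β) (a : β), (List.ofFn g).countP (· < a) =
        (Finset.univ.filter fun i => g i < a).card := by
      intro l g a
      induction l with
      | zero => simp
      | succ l ihl =>
        rw [List.ofFn_succ, List.countP_cons, ihl, Fin.card_filter_univ_succ']
        simp [add_comm]
    rw [List.ofFn_succ, listInv, ih, hcount]
    simp only [Finset.card_filter, Fintype.sum_prod_type, Fin.sum_univ_succ, Fin.succ_lt_succ_iff]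
    simp

theorem entryProd_finRange {B γ : Type*} [Ring B] {m : ℕ} (x : Fin m → γ → B) (f : Fin m → γ) :
    entryProd x (List.finRange m) (List.ofFn f) = (List.ofFn fun i => x i (f i)).prod := by
  have h : ∀ (k : ℕ) (r : Fin k → Fin m) (g : Fin k → γ),
      entryProd x (List.ofFn r) (List.ofFn g) = (List.ofFn fun i => x (r i) (g i)).prod := by
    intro k r g
    induction k with
    | zero => simp [entryProd]
    | succ k ih => simp [List.ofFn_succ, entryProd, ih]
  simpa [List.ofFn_id] using h m id f

end Expansion

section QuantumMatrices

variable {K : Type*} [Field K] (u : Kˣ) (m n : ℕ)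

theorem isQuantumMatrix_qX :
    IsQuantumMatrix (u : K) (qX K u : Fin m → Fin n → QuantumMat K u m n) where
  row i j l h := by
    simpa [qX] using RingQuot.mkAlgHom_rel K (qMatrixRel.row (u := u) i j l h)
  col i k j h := by
    simpa [qX] using RingQuot.mkAlgHom_rel K (qMatrixRel.col (u := u) i k j h)
  antidiag i k j l h h' := by
    simpa [qX] using RingQuot.mkAlgHom_rel K (qMatrixRel.antidiag (u := u) i k j l h h')
  diag i k j l h h' := by
    simpa [qX] using RingQuot.mkAlgHom_rel K (qMatrixRel.diag (u := u) i k j l h h')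

variable {m n}

theorem setMinor_qX (J : Fin m ↪o Fin n) :
    setMinor (u : K) (qX K u) (colSet J) = qMaximalMinor K u J := by
  classical
  rw [setMinor, rowMinor, List.length_finRange, qAlt_eq_sum_fun (card_colSet J),
    ← Finset.sum_filter, qMaximalMinor]
  symm
  refine Finset.sum_bij (fun σ _ => J ∘ σ) ?_ ?_ ?_ ?_
  · intro σ _
    simp [colSet, J.injective.comp σ.injective]
  · intro σ _ τ _ h
    exact Equiv.ext fun i => J.injective (congrFun h i)
  · intro f hf
    simp only [Finset.mem_filter, Finset.mem_univ, true_and, colSet, Finset.mem_map] at hf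
    obtain ⟨hinj, hf⟩ := hf
    choose g hg using hf
    have hginj : Function.Injective g := fun a b hab => hinj (by rw [← hg a, ← hg b, hab])
    exact ⟨Equiv.ofBijective g (Finite.injective_iff_bijective.1 hginj), Finset.mem_univ _,
      funext hg⟩
  · intro σ _
    rw [listInv_ofFn, entryProd_finRange]
    simp [permLength]

end QuantumMatrices

section StandardMonomials

variable {K A P : Type*} [Field K] [Ring A] [Algebra K A] {g : P → A}

theorem Subalgebra.mem_span_of_coe_mem_span {A' : Subalgebra K A} {s : Set A'} {a : A'}
    (h : (a : A) ∈ Submodule.span K ((↑) '' s : Set A)) : a ∈ Submodule.span K s := by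
  change (a : A) ∈ Submodule.span K (A'.val.toLinearMap '' s) at h
  rw [Submodule.span_image] at h
  obtain ⟨b, hb, hba⟩ := h
  rwa [← Subtype.val_injective hba]

theorem mem_span_prod_of_adjoin_eq_top (hg : Algebra.adjoin K (Set.range g) = ⊤) (a : A) :
    a ∈ Submodule.span K (Set.range fun l : List P => (l.map g).prod) := by
  have ha : a ∈ Subalgebra.toSubmodule (Algebra.adjoin K (Set.range g)) := by simp [hg]
  rw [Algebra.adjoin_eq_span] at ha
  refine Submodule.span_mono (fun b hb => ?_) ha
  obtain ⟨l, hl, rfl⟩ := Submonoid.exists_list_of_mem_closure hb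
  obtain ⟨l, rfl⟩ : l ∈ Set.range (List.map g) := by rwa [Set.range_list_map]
  exact ⟨l, rfl⟩

variable [PartialOrder P]

variable (K g) in
/-- The span of the standard monomials of degree `k + 1` whose first factor is at most `I`. -/
def stdSpan (k : ℕ) (I : P) : Submodule K A :=
  Submodule.span K {b | ∃ (I₁ : P) (tl : List P), (I₁ :: tl).IsChain (· ≤ ·) ∧ I₁ ≤ I ∧
    tl.length = k ∧ b = ((I₁ :: tl).map g).prod}

theorem stdSpan_mono (k : ℕ) {I J : P} (h : I ≤ J) : stdSpan K g k I ≤ stdSpan K g k J :=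
  Submodule.span_mono fun _ ⟨I₁, tl, h1, h2, h3⟩ => ⟨I₁, tl, h1, h2.trans h, h3⟩

/-- Straightening: every monomial is a combination of standard monomials of the same degree whose
first factor is at most the first factor of the given monomial. -/
theorem mul_prod_mem_stdSpan [Finite P]
    (hlt : ∀ I J, ¬ I ≤ J → g I * g J ∈
      Submodule.span K {b | ∃ I' J', I' < I ∧ b = g I' * g J'})
    (k : ℕ) (I : P) (l : List P) (hl : l.length = k) :
    g I * (l.map g).prod ∈ stdSpan K g k I := by
  induction k generalizing I l with
  | zero =>
    obtain rfl := List.length_eq_zero_iff.1 hl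
    exact Submodule.subset_span ⟨I, [], by simp, le_rfl, rfl, by simp⟩
  | succ k ih =>
    induction I using WellFoundedLT.induction generalizing l with
    | ind I ihI =>
      obtain ⟨J, l, rfl⟩ := List.exists_cons_of_length_eq_add_one hl
      rw [List.map_cons, List.prod_cons]
      refine map_mem_of_mem_span (LinearMap.mulLeft K (g I)) ?_ (ih J l (by simpa using hl))
      rintro _ ⟨J₁, tl, hchain, -, htl, rfl⟩
      by_cases hIJ : I ≤ J₁
      · exact Submodule.subset_span ⟨I, J₁ :: tl, List.isChain_cons_cons.2 ⟨hIJ, hchain⟩, le_rfl,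
          by simp [htl], by simp⟩
      · have := map_mem_of_mem_span (LinearMap.mulRight K (tl.map g).prod)
          (N := stdSpan K g (k + 1) I) ?_ (hlt I J₁ hIJ)
        · simpa [mul_assoc] using this
        · rintro _ ⟨I', J', hI', rfl⟩
          have := stdSpan_mono (k + 1) hI'.le (ihI I' hI' (J' :: tl) (by simp [htl]))
          simpa [mul_assoc] using this

/-- In an algebra with a straightening law and commutation relations, the two-sided ideal
generated by the generators `g π` with `π ≱ γ` is spanned by standard monomials, and it is
generated by these elements as a right ideal. -/
theorem coe_twoSidedIdeal_span_eq [Finite P] (hg : Algebra.adjoin K (Set.range g) = ⊤)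
    (hlt : ∀ I J, ¬ I ≤ J → g I * g J ∈
      Submodule.span K {b | ∃ I' J', I' < I ∧ b = g I' * g J'})
    (hswap : ∀ I J, g I * g J ∈ Submodule.span K {b | ∃ J' I', J' ≤ J ∧ b = g J' * g I'}) (γ : P) :
    (TwoSidedIdeal.span (g '' {π | ¬ γ ≤ π}) : Set A) =
      (Submodule.span K {b | ∃ (I₁ : P) (tl : List P), (I₁ :: tl).IsChain (· ≤ ·) ∧ ¬ γ ≤ I₁ ∧
        b = ((I₁ :: tl).map g).prod} : Set A) ∧
    (TwoSidedIdeal.span (g '' {π | ¬ γ ≤ π}) : Set A) =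
      (Submodule.span K {b | ∃ (π : P) (r : A), ¬ γ ≤ π ∧ b = g π * r} : Set A) := by
  set S := Submodule.span K {b | ∃ (I₁ : P) (tl : List P), (I₁ :: tl).IsChain (· ≤ ·) ∧
    ¬ γ ≤ I₁ ∧ b = ((I₁ :: tl).map g).prod} with hS
  set R := Submodule.span K {b | ∃ (π : P) (r : A), ¬ γ ≤ π ∧ b = g π * r} with hR
  set T := TwoSidedIdeal.span (g '' {π | ¬ γ ≤ π}) with hT
  have hRS : R ≤ S := by
    refine Submodule.span_le.2 ?_
    rintro _ ⟨π, r, hπ, rfl⟩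
    refine map_mem_of_mem_span (LinearMap.mulLeft K (g π)) ?_ (mem_span_prod_of_adjoin_eq_top hg r)
    rintro _ ⟨l, rfl⟩
    refine Submodule.span_mono ?_ (mul_prod_mem_stdSpan hlt _ π l rfl)
    rintro _ ⟨I₁, tl, hchain, hI₁, -, rfl⟩
    exact ⟨I₁, tl, hchain, fun h => hπ (h.trans hI₁), rfl⟩
  have hST : (S : Set A) ⊆ T := by
    intro b hb
    induction hb using Submodule.span_induction with
    | mem b hb =>
      obtain ⟨I₁, tl, -, hI₁, rfl⟩ := hb
      rw [List.map_cons, List.prod_cons]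
      exact T.mul_mem_right _ _ (TwoSidedIdeal.subset_span ⟨I₁, hI₁, rfl⟩)
    | zero => exact T.zero_mem
    | add b c _ _ hb hc => exact T.add_mem hb hc
    | smul e b _ hb =>
      rw [Algebra.smul_def]
      exact T.mul_mem_left _ _ hb
  have hright : ∀ b a : A, b ∈ R → b * a ∈ R := by
    intro b a hb
    refine map_mem_of_mem_span (LinearMap.mulRight K a) ?_ hb
    rintro _ ⟨π, r, hπ, rfl⟩
    exact Submodule.subset_span ⟨π, r * a, hπ, mul_assoc _ _ _⟩
  have hleft : ∀ a b : A, b ∈ R → a * b ∈ R := by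
    intro a b hb
    have ha : a ∈ Algebra.adjoin K (Set.range g) := by simp [hg]
    induction ha using Algebra.adjoin_induction generalizing b with
    | mem a ha =>
      obtain ⟨I, rfl⟩ := ha
      refine map_mem_of_mem_span (LinearMap.mulLeft K (g I)) ?_ hb
      rintro _ ⟨π, r, hπ, rfl⟩
      rw [LinearMap.mulLeft_apply, ← mul_assoc]
      refine hright _ r (Submodule.span_mono ?_ (hswap I π))
      rintro _ ⟨J', I', hJ', rfl⟩
      exact ⟨J', g I', fun h => hπ (h.trans hJ'), rfl⟩
    | algebraMap e =>
      rw [← Algebra.smul_def]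
      exact R.smul_mem e hb
    | add a c _ _ ha hc =>
      rw [add_mul]
      exact R.add_mem (ha b hb) (hc b hb)
    | mul a c _ _ ha hc =>
      rw [mul_assoc]
      exact ha _ (hc b hb)
  have hTR : (T : Set A) ⊆ R := by
    have h := TwoSidedIdeal.span_le (s := g '' {π | ¬ γ ≤ π}) (I := TwoSidedIdeal.mk' (R : Set A)
      R.zero_mem R.add_mem R.neg_mem (hleft _ _) (hright _ _)) |>.2 ?_
    · intro b hb
      simpa using h hb
    · rintro _ ⟨π, hπ, rfl⟩
      have : g π ∈ R := Submodule.subset_span ⟨π, 1, hπ, (mul_one _).symm⟩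
      simpa using this
  exact ⟨(hTR.trans hRS).antisymm hST, hTR.antisymm (Set.Subset.trans hRS hST)⟩

end StandardMonomials

/-- Let `q ∈ ℂ` be a nonzero non-root of unity, `m ≤ n` positive integers
and `γ ∈ Π_{m,n}`.  Then the two-sided ideal `I_γ` of `O_q(G_{m,n}(ℂ))` generated by
`Ω_γ = {[π] : π ≱st γ}` equals the `ℂ`-linear span of the standard monomials `[I₁]⋯[I_s]`
(`I₁ ≤st ⋯ ≤st I_s`) involving an element of `Ω_γ`, i.e. with `I₁ ∈ Ω_γ`; moreover `I_γ` is
generated by `Ω_γ` as a right ideal. -/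
theorem quantumSchubert_ideal_spans (q : ℂ) (hq : q ≠ 0)
    (hroot : ∀ s : ℕ, 0 < s → q ^ s ≠ 1)
    (m n : ℕ) (hm : 0 < m) (hmn : m ≤ n) (γ : Fin m ↪o Fin n) :
    (TwoSidedIdeal.span
        ((grMinor ℂ (Units.mk0 q hq)) '' {π : Fin m ↪o Fin n | ¬ γ ≤ π}) :
        Set (QuantumGrassmannian ℂ (Units.mk0 q hq) m n)) =
      (Submodule.span ℂ
        {x : QuantumGrassmannian ℂ (Units.mk0 q hq) m n |
          ∃ (I₁ : Fin m ↪o Fin n) (tl : List (Fin m ↪o Fin n)),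
            (I₁ :: tl).Chain' (· ≤ ·) ∧ ¬ γ ≤ I₁ ∧
            x = ((I₁ :: tl).map (grMinor ℂ (Units.mk0 q hq))).prod} :
        Set (QuantumGrassmannian ℂ (Units.mk0 q hq) m n)) ∧
    (TwoSidedIdeal.span
        ((grMinor ℂ (Units.mk0 q hq)) '' {π : Fin m ↪o Fin n | ¬ γ ≤ π}) :
        Set (QuantumGrassmannian ℂ (Units.mk0 q hq) m n)) =
      (Submodule.span ℂ
        {x : QuantumGrassmannian ℂ (Units.mk0 q hq) m n |
          ∃ (π : Fin m ↪o Fin n) (r : QuantumGrassmannian ℂ (Units.mk0 q hq) m n),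
            ¬ γ ≤ π ∧ x = grMinor ℂ (Units.mk0 q hq) π * r} :
        Set (QuantumGrassmannian ℂ (Units.mk0 q hq) m n)) := by
  have hx := isQuantumMatrix_qX (Units.mk0 q hq) m n
  refine coe_twoSidedIdeal_span_eq ?_ (fun I J hIJ => ?_) (fun I J => ?_) γ
  · have h := Algebra.adjoin_adjoin_coe_preimage (R := ℂ)
      (s := Set.range fun J : Fin m ↪o Fin n => qMaximalMinor ℂ (Units.mk0 q hq) J)
    have hrange : Set.range (grMinor ℂ (Units.mk0 q hq)) = Subtype.val ⁻¹'
        Set.range fun J : Fin m ↪o Fin n => qMaximalMinor ℂ (Units.mk0 q hq) J := by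
      ext a
      simp [grMinor, Subtype.ext_iff]
    rw [hrange]
    exact h
  · have h := hx.setMinor_mul_mem_span_lt hq hroot hIJ
    simp only [setMinor_qX] at h
    refine Subalgebra.mem_span_of_coe_mem_span (Submodule.span_mono ?_ h)
    rintro _ ⟨I', J', hI', rfl⟩
    exact ⟨_, ⟨I', J', hI', rfl⟩, rfl⟩
  · have h := hx.setMinor_mul_mem_span_swap hq hroot I J
    simp only [setMinor_qX] at h
    refine Subalgebra.mem_span_of_coe_mem_span (Submodule.span_mono ?_ h)
    rintro _ ⟨J', I', hJ', rfl⟩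
    exact ⟨_, ⟨J', I', hJ', rfl⟩, rfl⟩
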